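/- Let B be a skew brace and define r_B : B × B → B × B by r_B(a,b) = (λ_a(b), λ_a(b)^{-1} ∘ a ∘ b). Then (B, r_B) is a non-degenerate set-theoretic solution of the Yang–Baxter equation: r_B is bijective, satisfies (r_B×id)(id×r_B)(r_B×id) = (id×r_B)(r_B×id)(id×r_B) on B × B × B, and, writing r_B(a,b) = (σ_a(b), τ_b(a)), all maps σ_a and τ_b are bijective. -/

import Mathlib

universe u v

/-- A skew (left) brace: two group structures `(B,+)` and `(B,∘)` on the same set,
sharing the same identity element `zero` (recall that in any skew brace `0 = 1`),
satisfying the skew left distributive law `a ∘ (b + c) = a ∘ b - a + a ∘ c`. -/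
structure SkewBrace (B : Type u) where
  add : B → B → B
  zero : B
  neg : B → B
  mul : B → B → B
  inv : B → B
  add_assoc : ∀ a b c, add (add a b) c = add a (add b c)
  zero_add : ∀ a, add zero a = a
  add_zero : ∀ a, add a zero = a
  neg_add : ∀ a, add (neg a) a = zero
  add_neg : ∀ a, add a (neg a) = zero
  mul_assoc : ∀ a b c, mul (mul a b) c = mul a (mul b c)
  zero_mul : ∀ a, mul zero a = a
  mul_zero : ∀ a, mul a zero = a
  inv_mul : ∀ a, mul (inv a) a = zero
  mul_inv : ∀ a, mul a (inv a) = zero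
  compat : ∀ a b c, mul a (add b c) = add (add (mul a b) (neg a)) (mul a c)

namespace SkewBrace

variable {B C Q : Type u}

/-- `λ_a (b) = -a + a ∘ b`. -/
def lam (S : SkewBrace B) (a b : B) : B := S.add (S.neg a) (S.mul a b)

/-- `a ∗ b = λ_a(b) - b = -a + a ∘ b - b`. -/
def star (S : SkewBrace B) (a b : B) : B := S.add (S.lam a b) (S.neg b)

/-- A sub-skew brace: a subset containing the identity and closed under both group
operations and both inverses. -/
def IsSub (S : SkewBrace B) (T : Set B) : Prop :=
  S.zero ∈ T ∧ (∀ a ∈ T, ∀ b ∈ T, S.add a b ∈ T) ∧ (∀ a ∈ T, S.neg a ∈ T) ∧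
    (∀ a ∈ T, ∀ b ∈ T, S.mul a b ∈ T) ∧ (∀ a ∈ T, S.inv a ∈ T)

/-- The sub-skew brace generated by a subset. -/
def subGen (S : SkewBrace B) (X : Set B) : Set B := ⋂₀ {T | S.IsSub T ∧ X ⊆ T}

/-- A skew brace is finitely generated if a finite subset generates it. -/
def FinitelyGenerated (S : SkewBrace B) : Prop := ∃ T : Finset B, S.subGen ↑T = Set.univ

/-- A subgroup of the additive group `(B,+)`. -/
def IsAddSubgroup (S : SkewBrace B) (T : Set B) : Prop :=
  S.zero ∈ T ∧ (∀ a ∈ T, ∀ b ∈ T, S.add a b ∈ T) ∧ ∀ a ∈ T, S.neg a ∈ T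

/-- A subgroup of the multiplicative group `(B,∘)`. -/
def IsMulSubgroup (S : SkewBrace B) (T : Set B) : Prop :=
  S.zero ∈ T ∧ (∀ a ∈ T, ∀ b ∈ T, S.mul a b ∈ T) ∧ ∀ a ∈ T, S.inv a ∈ T

/-- The additive subgroup generated by a subset. -/
def addClosure (S : SkewBrace B) (X : Set B) : Set B := ⋂₀ {T | S.IsAddSubgroup T ∧ X ⊆ T}

/-- The multiplicative subgroup generated by a subset. -/
def mulClosure (S : SkewBrace B) (X : Set B) : Set B := ⋂₀ {T | S.IsMulSubgroup T ∧ X ⊆ T}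

/-- The group `(B,+)` is finitely generated. -/
def AddFG (S : SkewBrace B) : Prop := ∃ T : Finset B, S.addClosure ↑T = Set.univ

/-- The group `(B,∘)` is finitely generated. -/
def MulFG (S : SkewBrace B) : Prop := ∃ T : Finset B, S.mulClosure ↑T = Set.univ

/-- An ideal of a skew brace: a subgroup of `(B,+)`, normal in `(B,+)` and in `(B,∘)`,
invariant under all the maps `λ_b`. -/
def IsIdeal (S : SkewBrace B) (I : Set B) : Prop :=
  S.IsAddSubgroup I ∧ (∀ b : B, ∀ a ∈ I, S.add (S.add b a) (S.neg b) ∈ I) ∧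
    (∀ b : B, ∀ a ∈ I, S.mul (S.mul b a) (S.inv b) ∈ I) ∧
    ∀ b : B, ∀ a ∈ I, S.lam b a ∈ I

/-- The ideal generated by a subset (the smallest ideal containing it). -/
def idealGen (S : SkewBrace B) (X : Set B) : Set B := ⋂₀ {I | S.IsIdeal I ∧ X ⊆ I}

/-- A homomorphism of skew braces. -/
def IsHom (S : SkewBrace B) (T : SkewBrace C) (f : B → C) : Prop :=
  (∀ a b, f (S.add a b) = T.add (f a) (f b)) ∧ ∀ a b, f (S.mul a b) = T.mul (f a) (f b)

/-- `SF` together with `ι : X → F` is the free skew brace on `X`: every map from `X`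
to a skew brace extends uniquely to a homomorphism. -/
def IsFreeOn {F : Type u} {X : Type v} (SF : SkewBrace F) (ι : X → F) : Prop :=
  ∀ (C : Type u) (SC : SkewBrace C) (f : X → C),
    ∃! g : F → C, IsHom SF SC g ∧ ∀ x, g (ι x) = f x

/-- A skew brace is finitely presented if it is the image of a free skew brace on a
finite set under a homomorphism whose kernel is generated, as an ideal, by finitely
many elements. -/
def FinitelyPresented (S : SkewBrace B) : Prop :=
  ∃ (F : Type u) (SF : SkewBrace F) (m : ℕ) (ι : Fin m → F) (θ : F → B),
    IsFreeOn SF ι ∧ IsHom SF S θ ∧ Function.Surjective θ ∧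
      ∃ R : Finset F, {x | θ x = S.zero} = SF.idealGen ↑R

/-- `π : B → Q` realizes `Q` as the quotient skew brace `B/I`. -/
def IsQuotientBy (S : SkewBrace B) (I : Set B) (SQ : SkewBrace Q) (π : B → Q) : Prop :=
  IsHom S SQ π ∧ Function.Surjective π ∧ {x | π x = SQ.zero} = I

/-- The group `(B,+)` is finitely presented (as an abstract group). -/
def AddFP (S : SkewBrace B) : Prop :=
  ∃ (m : ℕ) (f : FreeGroup (Fin m) → B),
    (∀ x y, f (x * y) = S.add (f x) (f y)) ∧ Function.Surjective f ∧
      ∃ R : Finset (FreeGroup (Fin m)),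
        {x | f x = S.zero} = ↑(Subgroup.normalClosure (R : Set (FreeGroup (Fin m))))

/-- The group `(B,∘)` is finitely presented (as an abstract group). -/
def MulFP (S : SkewBrace B) : Prop :=
  ∃ (m : ℕ) (f : FreeGroup (Fin m) → B),
    (∀ x y, f (x * y) = S.mul (f x) (f y)) ∧ Function.Surjective f ∧
      ∃ R : Finset (FreeGroup (Fin m)),
        {x | f x = S.zero} = ↑(Subgroup.normalClosure (R : Set (FreeGroup (Fin m))))

/-- The ascending chain condition on sub-skew braces. -/
def SubACC (S : SkewBrace B) : Prop :=
  ∀ f : ℕ → Set B, Monotone f → (∀ n, S.IsSub (f n)) → ∃ n, ∀ m, n ≤ m → f m = f n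

/-- The ascending chain condition on subgroups of `(B,+)`. -/
def AddACC (S : SkewBrace B) : Prop :=
  ∀ f : ℕ → Set B, Monotone f → (∀ n, S.IsAddSubgroup (f n)) → ∃ n, ∀ m, n ≤ m → f m = f n

/-- The socle `Soc(B) = Ker(λ) ∩ Z(B,+)`. -/
def soc (S : SkewBrace B) : Set B :=
  {x | (∀ b, S.lam x b = b) ∧ ∀ b, S.add x b = S.add b x}

/-- The centre of the additive group `(B,+)`. -/
def addCenter (S : SkewBrace B) : Set B := {x | ∀ b, S.add x b = S.add b x}

/-- The preimage in `B` of `Ann(B/I)` (for `I` an ideal): the set of `x` such that,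
modulo `I`, `λ_x = id`, `x` is central in `(B,+)` and `x` is central in `(B,∘)`. -/
def annStep (S : SkewBrace B) (I : Set B) : Set B :=
  {x | (∀ b, S.add (S.lam x b) (S.neg b) ∈ I) ∧
       (∀ b, S.add (S.add x b) (S.neg (S.add b x)) ∈ I) ∧
       ∀ b, S.mul (S.mul x b) (S.inv (S.mul b x)) ∈ I}

/-- The preimage in `B` of `Soc(B/I)` (for `I` an ideal). -/
def socStep (S : SkewBrace B) (I : Set B) : Set B :=
  {x | (∀ b, S.add (S.lam x b) (S.neg b) ∈ I) ∧
       ∀ b, S.add (S.add x b) (S.neg (S.add b x)) ∈ I}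

/-- The upper annihilator series `Ann_α(B)`, defined by transfinite recursion. -/
noncomputable def annSeries (S : SkewBrace B) (o : Ordinal.{v}) : Set B :=
  Ordinal.limitRecOn o {S.zero} (fun _ ih => S.annStep ih)
    fun _o _ ih => ⋃ β, ⋃ h : β < _o, ih β h

/-- The upper socle series `Soc_α(B)`, defined by transfinite recursion. -/
noncomputable def socSeries (S : SkewBrace B) (o : Ordinal.{v}) : Set B :=
  Ordinal.limitRecOn o {S.zero} (fun _ ih => S.socStep ih)
    fun _o _ ih => ⋃ β, ⋃ h : β < _o, ih β h

/-- The solution of the YBE associated with a skew brace: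
`r_B(a,b) = (λ_a(b), λ_a(b)⁻¹ ∘ a ∘ b)`. -/
def braceR (S : SkewBrace B) : B × B → B × B :=
  fun p => (S.lam p.1 p.2, S.mul (S.inv (S.lam p.1 p.2)) (S.mul p.1 p.2))

end SkewBrace

/-- The set-theoretic Yang–Baxter (braid) equation
`(r × id)(id × r)(r × id) = (id × r)(r × id)(id × r)`. -/
def ybe {X : Type u} (r : X × X → X × X) : Prop :=
  let r₁ : X × X × X → X × X × X := fun p =>
    ((r (p.1, p.2.1)).1, (r (p.1, p.2.1)).2, p.2.2)
  let r₂ : X × X × X → X × X × X := fun p => (p.1, r p.2)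
  r₁ ∘ r₂ ∘ r₁ = r₂ ∘ r₁ ∘ r₂

/-- A non-degenerate set-theoretic solution: `r` is bijective, satisfies the YBE, and
writing `r (x,y) = (σ_x y, τ_y x)`, all maps `σ_x` and `τ_y` are bijective. -/
def IsNonDegenerateSolution {X : Type u} (r : X × X → X × X) : Prop :=
  Function.Bijective r ∧ ybe r ∧
    (∀ x, Function.Bijective fun y => (r (x, y)).1) ∧
    ∀ y, Function.Bijective fun x => (r (x, y)).2

/-- `S` (with the distinguished map `ι : X → B`) is the structure skew brace of the
solution `(X,r)`: the multiplicative group of `S` is the structure group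
`G(X,r) = ⟨X | x y = σ_x(y) τ_y(x)⟩` (expressed by the relations holding together
with the universal property of the presentation) and `r_S ∘ (ι × ι) = (ι × ι) ∘ r`. -/
def IsStructureSkewBrace {X B : Type u} (r : X × X → X × X)
    (S : SkewBrace B) (ι : X → B) : Prop :=
  (∀ x y, S.mul (ι x) (ι y) = S.mul (ι (r (x, y)).1) (ι (r (x, y)).2)) ∧
  (∀ (H : Type u) [Group H] (f : X → H),
      (∀ x y, f x * f y = f (r (x, y)).1 * f (r (x, y)).2) →
      ∃! φ : B → H, (∀ a b, φ (S.mul a b) = φ a * φ b) ∧ ∀ x, φ (ι x) = f x) ∧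
  ∀ x y, S.braceR (ι x, ι y) = (ι (r (x, y)).1, ι (r (x, y)).2)

namespace SkewBrace

variable {B : Type u}

theorem neg_add_cancel_left (S : SkewBrace B) (a b : B) :
    S.add (S.neg a) (S.add a b) = b := by
  rw [← S.add_assoc, S.neg_add, S.zero_add]

theorem add_neg_cancel_left (S : SkewBrace B) (a b : B) :
    S.add a (S.add (S.neg a) b) = b := by
  rw [← S.add_assoc, S.add_neg, S.zero_add]

theorem inv_mul_cancel_left (S : SkewBrace B) (a b : B) :
    S.mul (S.inv a) (S.mul a b) = b := by
  rw [← S.mul_assoc, S.inv_mul, S.zero_mul]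

theorem mul_inv_cancel_left (S : SkewBrace B) (a b : B) :
    S.mul a (S.mul (S.inv a) b) = b := by
  rw [← S.mul_assoc, S.mul_inv, S.zero_mul]

theorem inv_eq_of_mul_eq_zero (S : SkewBrace B) {a b : B} (h : S.mul a b = S.zero) :
    S.inv a = b := by
  rw [← S.inv_mul_cancel_left a b, h, S.mul_zero]

theorem inv_inv (S : SkewBrace B) (a : B) : S.inv (S.inv a) = a :=
  S.inv_eq_of_mul_eq_zero (S.inv_mul a)

theorem mul_inv_rev (S : SkewBrace B) (a b : B) :
    S.inv (S.mul a b) = S.mul (S.inv b) (S.inv a) :=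
  S.inv_eq_of_mul_eq_zero (by rw [S.mul_assoc, S.mul_inv_cancel_left, S.mul_inv])

theorem neg_eq_of_add_eq_zero (S : SkewBrace B) {a b : B} (h : S.add a b = S.zero) :
    S.neg a = b := by
  rw [← S.neg_add_cancel_left a b, h, S.add_zero]

theorem neg_neg (S : SkewBrace B) (a : B) : S.neg (S.neg a) = a :=
  S.neg_eq_of_add_eq_zero (S.neg_add a)

theorem neg_add_rev (S : SkewBrace B) (a b : B) :
    S.neg (S.add a b) = S.add (S.neg b) (S.neg a) :=
  S.neg_eq_of_add_eq_zero (by rw [S.add_assoc, S.add_neg_cancel_left, S.add_neg])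

theorem add_lam (S : SkewBrace B) (a b : B) : S.add a (S.lam a b) = S.mul a b :=
  S.add_neg_cancel_left a _

theorem lam_add (S : SkewBrace B) (a b c : B) :
    S.lam a (S.add b c) = S.add (S.lam a b) (S.lam a c) := by
  simp only [lam, S.compat, S.add_assoc]

theorem lam_zero_right (S : SkewBrace B) (a : B) : S.lam a S.zero = S.zero := by
  rw [lam, S.mul_zero, S.neg_add]

theorem lam_zero_left (S : SkewBrace B) (b : B) : S.lam S.zero b = b := by
  rw [← S.zero_add (S.lam S.zero b), S.add_lam, S.zero_mul]

theorem lam_neg (S : SkewBrace B) (a b : B) : S.lam a (S.neg b) = S.neg (S.lam a b) :=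
  (S.neg_eq_of_add_eq_zero (by rw [← S.lam_add, S.add_neg, S.lam_zero_right])).symm

theorem lam_mul (S : SkewBrace B) (a b c : B) :
    S.lam (S.mul a b) c = S.lam a (S.lam b c) := by
  change _ = S.lam a (S.add (S.neg b) (S.mul b c))
  rw [S.lam_add, S.lam_neg]
  simp only [lam, S.neg_add_rev, S.neg_neg, S.add_assoc, S.add_neg_cancel_left, S.mul_assoc]

theorem lam_bijective (S : SkewBrace B) (a : B) : Function.Bijective (S.lam a) :=
  Function.bijective_iff_has_inverse.mpr ⟨S.lam (S.inv a),
    fun b => by rw [← S.lam_mul, S.inv_mul, S.lam_zero_left],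
    fun b => by rw [← S.lam_mul, S.mul_inv, S.lam_zero_left]⟩

/-- The second component `τ_b(a)` of `r_B(a,b)`. -/
def rho (S : SkewBrace B) (a b : B) : B := S.mul (S.inv (S.lam a b)) (S.mul a b)

theorem lam_mul_rho (S : SkewBrace B) (a b : B) :
    S.mul (S.lam a b) (S.rho a b) = S.mul a b :=
  S.mul_inv_cancel_left _ _

theorem lam_eq_mul (S : SkewBrace B) (a b : B) :
    S.lam a b = S.mul a (S.add (S.inv a) b) := by
  rw [S.compat, S.mul_inv, S.zero_add, lam]

theorem rho_eq (S : SkewBrace B) (a b : B) :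
    S.rho a b = S.mul (S.inv (S.add (S.inv a) b)) b := by
  rw [rho, S.lam_eq_mul, S.mul_inv_rev, S.mul_assoc, S.inv_mul_cancel_left]

theorem rho_bijective (S : SkewBrace B) (b : B) : Function.Bijective fun a => S.rho a b := by
  refine Function.bijective_iff_has_inverse.mpr
    ⟨fun v => S.inv (S.add (S.mul b (S.inv v)) (S.neg b)), fun a => ?_, fun v => ?_⟩
  · simp only [S.rho_eq, S.mul_inv_rev, S.inv_inv, S.mul_inv_cancel_left, S.add_assoc,
      S.add_neg, S.add_zero]
  · simp only [S.rho_eq, S.mul_inv_rev, S.inv_inv, S.add_assoc, S.neg_add, S.add_zero,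
      S.mul_assoc, S.inv_mul, S.mul_zero]

theorem braceR_bijective (S : SkewBrace B) : Function.Bijective S.braceR := by
  refine Function.bijective_iff_has_inverse.mpr
    ⟨fun p => (S.add (S.mul p.1 p.2) (S.neg p.1),
      S.mul (S.inv (S.add (S.mul p.1 p.2) (S.neg p.1))) (S.mul p.1 p.2)), ?_, ?_⟩
  · rintro ⟨a, b⟩
    have h : S.add (S.mul a b) (S.neg (S.lam a b)) = a := by
      rw [lam, S.neg_add_rev, S.neg_neg, S.add_neg_cancel_left]
    simp only [braceR, S.mul_inv_cancel_left, h, S.inv_mul_cancel_left]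
  · rintro ⟨u, v⟩
    have h : S.lam (S.add (S.mul u v) (S.neg u))
        (S.mul (S.inv (S.add (S.mul u v) (S.neg u))) (S.mul u v)) = u := by
      rw [lam, S.mul_inv_cancel_left, S.neg_add_rev, S.neg_neg, S.add_assoc, S.neg_add,
        S.add_zero]
    simp only [braceR, h, S.mul_inv_cancel_left, S.inv_mul_cancel_left]

theorem mul_left_cancel (S : SkewBrace B) {a b c : B} (h : S.mul a b = S.mul a c) : b = c := by
  rw [← S.inv_mul_cancel_left a b, h, S.inv_mul_cancel_left]

theorem lam_lam_rho (S : SkewBrace B) (a b c : B) :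
    S.lam (S.lam a b) (S.lam (S.rho a b) c) = S.lam a (S.lam b c) := by
  rw [← S.lam_mul, S.lam_mul_rho, S.lam_mul]

theorem lam_mul_lam_rho (S : SkewBrace B) (a b c : B) :
    S.mul (S.lam a b) (S.lam (S.rho a b) c) = S.lam a (S.mul b c) := by
  rw [← S.add_lam, S.lam_lam_rho, ← S.lam_add, S.add_lam]

theorem rho_lam_rho (S : SkewBrace B) (a b c : B) :
    S.rho (S.lam a b) (S.lam (S.rho a b) c) = S.lam (S.rho a (S.lam b c)) (S.rho b c) := by
  apply S.mul_left_cancel (a := S.lam a (S.lam b c))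
  rw [S.lam_mul_lam_rho, S.lam_mul_rho, ← S.lam_lam_rho, S.lam_mul_rho, S.lam_mul_lam_rho]

theorem rho_rho (S : SkewBrace B) (a b c : B) :
    S.rho (S.rho a b) c = S.rho (S.rho a (S.lam b c)) (S.rho b c) := by
  apply S.mul_left_cancel (a := S.lam (S.rho a (S.lam b c)) (S.rho b c))
  apply S.mul_left_cancel (a := S.lam a (S.lam b c))
  rw [S.lam_mul_rho (S.rho a (S.lam b c)), ← S.rho_lam_rho, ← S.mul_assoc, ← S.mul_assoc,
    S.lam_mul_rho a (S.lam b c), ← S.lam_lam_rho, S.lam_mul_rho (S.lam a b), S.mul_assoc,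
    S.lam_mul_rho, ← S.mul_assoc, S.lam_mul_rho, S.mul_assoc, S.mul_assoc, S.lam_mul_rho]

theorem braceR_ybe (S : SkewBrace B) : ybe S.braceR := by
  funext ⟨a, b, c⟩
  exact Prod.ext (S.lam_lam_rho a b c) (Prod.ext (S.rho_lam_rho a b c) (S.rho_rho a b c))

end SkewBrace

/-- **Theorem.** For any skew brace `B`, the pair `(B, r_B)` with
`r_B(a,b) = (λ_a(b), λ_a(b)⁻¹ ∘ a ∘ b)` is a non-degenerate set-theoretic solution of
the Yang–Baxter equation: `r_B` is bijective, satisfies the braid relation, and all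
the maps `σ_a = (r_B(a,·)).1` and `τ_b = (r_B(·,b)).2` are bijective. -/
theorem braceR_is_nondegenerate_solution {B : Type u} (S : SkewBrace B) :
    IsNonDegenerateSolution S.braceR := by
  exact ⟨S.braceR_bijective, S.braceR_ybe, S.lam_bijective, S.rho_bijective⟩
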